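/- Let x ∈ S̃_{k+1} and let x = d_{A_n} ⋯ d_{A_1} be its canonical maximal decomposition, i.e., each A_m ⊊ I is nonempty, ℓ(x) = ∑_{m=1}^{n} |A_m|, and A_{m+1} ⊆ A_m − 1 for all 1 ≤ m < n. Then for every residue i ∈ I, CRD(x)_i = card{m ∈ {1, …, n} : i − m ∈ A_m} (with i − m computed in I). In other words, the affine code of x coincides with the k-code of its canonical cyclically decreasing decomposition. -/

import Mathlib

/-- `x : Equiv.Perm ℤ` is an affine permutation in `S̃_{k+1}`: it commutes with
translation by `k+1` and its window sums to `(k+1)(k+2)/2`. -/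
def IsAffinePerm (k : ℕ) (x : Equiv.Perm ℤ) : Prop :=
  (∀ i : ℤ, x (i + (k + 1)) = x i + (k + 1)) ∧
  ∑ i ∈ Finset.Icc (1 : ℤ) (k + 1), x i = (k + 1) * (k + 2) / 2

/-- The underlying function of the simple generator `s_i`. -/
def sAffFun (k : ℕ) (i : ZMod (k + 1)) (j : ℤ) : ℤ :=
  if (j : ZMod (k + 1)) = i then j + 1
  else if (j : ZMod (k + 1)) = i + 1 then j - 1
  else j

theorem sAffFun_invol (k : ℕ) (i : ZMod (k + 1)) (h : ¬ (1 : ZMod (k + 1)) = 0) :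
    Function.Involutive (sAffFun k i) := by
  have hne : i + 1 ≠ i := fun hc => h (by
    have h2 : i + 1 = i + 0 := by simpa using hc
    exact add_left_cancel h2)
  intro j
  by_cases h1 : (j : ZMod (k + 1)) = i
  · have e1 : sAffFun k i j = j + 1 := if_pos h1
    have hj1 : ((j + 1 : ℤ) : ZMod (k + 1)) = i + 1 := by push_cast; rw [h1]
    have e2 : sAffFun k i (j + 1) = j := by
      unfold sAffFun
      rw [if_neg (by rw [hj1]; exact hne), if_pos hj1]
      ring
    rw [e1, e2]
  · by_cases h2 : (j : ZMod (k + 1)) = i + 1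
    · have e1 : sAffFun k i j = j - 1 := by unfold sAffFun; rw [if_neg h1, if_pos h2]
      have hj1 : ((j - 1 : ℤ) : ZMod (k + 1)) = i := by push_cast; rw [h2]; ring
      have e2 : sAffFun k i (j - 1) = j := by
        unfold sAffFun; rw [if_pos hj1]; ring
      rw [e1, e2]
    · have e1 : sAffFun k i j = j := by unfold sAffFun; rw [if_neg h1, if_neg h2]
      rw [e1, e1]

/-- The simple generator `s_i` of the affine symmetric group, as a permutation of `ℤ`:
it interchanges `m(k+1) + ī` and `m(k+1) + ī + 1` for every `m` (when `k ≥ 1`). -/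
noncomputable def sAff (k : ℕ) (i : ZMod (k + 1)) : Equiv.Perm ℤ :=
  if h : (1 : ZMod (k + 1)) = 0 then 1 else Function.Involutive.toPerm _ (sAffFun_invol k i h)

/-- The Coxeter length of `x`: the least number of simple generators whose product is `x`. -/
noncomputable def affLen (k : ℕ) (x : Equiv.Perm ℤ) : ℕ :=
  sInf {n : ℕ | ∃ w : List (ZMod (k + 1)), w.length = n ∧ x = (w.map (sAff k)).prod}

/-- The right descent set `D_R(x) = {i : ℓ(x s_i) < ℓ(x)}`. -/
noncomputable def rightDescents (k : ℕ) (x : Equiv.Perm ℤ) : Set (ZMod (k + 1)) :=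
  {i | affLen k (x * sAff k i) < affLen k x}

/-- The cyclic interval `[i,j] = {i, i+1, …, j}` of residues mod `k+1`. -/
def cycInt (k : ℕ) (i j : ZMod (k + 1)) : Finset (ZMod (k + 1)) :=
  (Finset.range ((j - i).val + 1)).image fun t : ℕ => i + (t : ZMod (k + 1))

/-- A choice of a "gate" residue not belonging to `A` (when `A` is proper). -/
noncomputable def gate (k : ℕ) (A : Finset (ZMod (k + 1))) : ZMod (k + 1) :=
  if h : ∃ g, g ∉ A then h.choose else 0

/-- The cyclically decreasing element `d_A`: the product of the `s_a`, `a ∈ A`, in an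
order where `s_{a+1}` occurs to the left of `s_a` whenever `a, a+1 ∈ A`. -/
noncomputable def dElt (k : ℕ) (A : Finset (ZMod (k + 1))) : Equiv.Perm ℤ :=
  (((((List.range (k + 1)).reverse.map fun t : ℕ => gate k A + (t : ZMod (k + 1))).filter
      fun a => decide (a ∈ A)).map (sAff k)).prod)

/-- The cyclically increasing element `u_A`: the product of the `s_a`, `a ∈ A`, in an
order where `s_{a+1}` occurs to the right of `s_a` whenever `a, a+1 ∈ A`. -/
noncomputable def uElt (k : ℕ) (A : Finset (ZMod (k + 1))) : Equiv.Perm ℤ :=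
  ((((List.range (k + 1)).map fun t : ℕ => gate k A + (t : ZMod (k + 1))).filter
      fun a => decide (a ∈ A)).map (sAff k)).prod

/-- The right decreasing code: `CRD(x)_i = #{j < ī : x(j) > x(ī)}`. -/
noncomputable def CRD (k : ℕ) (x : Equiv.Perm ℤ) (i : ZMod (k + 1)) : ℕ :=
  Set.ncard {j : ℤ | j < (i.val : ℤ) ∧ x (i.val : ℤ) < x j}

/-- The right increasing code: `CRI(x)_i = #{j > ī + 1 : x(j) < x(ī + 1)}`. -/
noncomputable def CRI (k : ℕ) (x : Equiv.Perm ℤ) (i : ZMod (k + 1)) : ℕ :=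
  Set.ncard {j : ℤ | (i.val : ℤ) + 1 < j ∧ x j < x ((i.val : ℤ) + 1)}

/-- The left decreasing code: `CLD(x)_i = #{j < x⁻¹(ī + 1) : x(j) > ī + 1}`. -/
noncomputable def CLD (k : ℕ) (x : Equiv.Perm ℤ) (i : ZMod (k + 1)) : ℕ :=
  Set.ncard {j : ℤ | j < x.symm ((i.val : ℤ) + 1) ∧ (i.val : ℤ) + 1 < x j}

/-- The left increasing code: `CLI(x)_i = #{j > x⁻¹(ī) : x(j) < ī}`. -/
noncomputable def CLI (k : ℕ) (x : Equiv.Perm ℤ) (i : ZMod (k + 1)) : ℕ :=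
  Set.ncard {j : ℤ | x.symm ((i.val : ℤ)) < j ∧ x j < (i.val : ℤ)}

/-- The combinatorial description of the one-line notation of a cyclically decreasing element:
positions following a residue of `S` move one step left, the others jump to the first position
on their right whose residue is outside `S`. -/
structure IsCycDecreasing (k : ℕ) (S : Set (ZMod (k + 1))) (D : Equiv.Perm ℤ) : Prop where
  apply_of_mem : ∀ j : ℤ, ((j - 1 : ℤ) : ZMod (k + 1)) ∈ S → D j = j - 1
  le_apply : ∀ j : ℤ, ((j - 1 : ℤ) : ZMod (k + 1)) ∉ S → j ≤ D j
  apply_notMem : ∀ j : ℤ, ((j - 1 : ℤ) : ZMod (k + 1)) ∉ S → (D j : ZMod (k + 1)) ∉ S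
  mem_of_lt_apply : ∀ j : ℤ, ((j - 1 : ℤ) : ZMod (k + 1)) ∉ S →
    ∀ l : ℤ, j ≤ l → l < D j → (l : ZMod (k + 1)) ∈ S

theorem isCycDecreasing_one (k : ℕ) : IsCycDecreasing k ∅ 1 where
  apply_of_mem _ h := h.elim
  le_apply _ _ := le_rfl
  apply_notMem _ _ h := h
  mem_of_lt_apply _ _ _ h₁ h₂ := absurd h₂ (not_lt.mpr h₁)

theorem zmod_one_ne_zero {k : ℕ} (hk : 1 ≤ k) : (1 : ZMod (k + 1)) ≠ 0 := by
  have : Fact (1 < k + 1) := ⟨by omega⟩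
  exact one_ne_zero

theorem sAff_apply {k : ℕ} (hk : 1 ≤ k) (i : ZMod (k + 1)) (j : ℤ) :
    sAff k i j = sAffFun k i j := by
  rw [sAff, dif_neg (zmod_one_ne_zero hk)]
  rfl

theorem IsCycDecreasing.sAff_mul {k : ℕ} (hk : 1 ≤ k) {S : Set (ZMod (k + 1))}
    {D : Equiv.Perm ℤ} (hD : IsCycDecreasing k S D) {b : ZMod (k + 1)} (hb : b ∉ S)
    (hb' : b + 1 ∉ S) : IsCycDecreasing k (insert b S) (sAff k b * D) := by
  have hne : b + 1 ≠ b := fun h => zmod_one_ne_zero hk (by simpa using h)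
  have fixed : ∀ r : ℤ, (r : ZMod (k + 1)) ≠ b → (r : ZMod (k + 1)) ≠ b + 1 →
      sAff k b r = r := fun r h₁ h₂ => by
    rw [sAff_apply hk, sAffFun, if_neg h₁, if_neg h₂]
  have up : ∀ r : ℤ, (r : ZMod (k + 1)) = b → sAff k b r = r + 1 := fun r h => by
    rw [sAff_apply hk, sAffFun, if_pos h]
  have down : ∀ r : ℤ, (r : ZMod (k + 1)) = b + 1 → sAff k b r = r - 1 := fun r h => by
    rw [sAff_apply hk, sAffFun, if_neg (by rw [h]; exact hne), if_pos h]
  have jump : ∀ j : ℤ, ((j - 1 : ℤ) : ZMod (k + 1)) ∉ insert b S →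
      j ≤ sAff k b (D j) ∧ (sAff k b (D j) : ZMod (k + 1)) ∉ insert b S ∧
        ∀ l : ℤ, j ≤ l → l < sAff k b (D j) → (l : ZMod (k + 1)) ∈ insert b S := by
    intro j hj
    rw [Set.mem_insert_iff, not_or] at hj
    obtain ⟨hjb, hj⟩ := hj
    have h₁ := hD.le_apply j hj
    have h₂ := hD.apply_notMem j hj
    have h₃ := hD.mem_of_lt_apply j hj
    by_cases hr : (D j : ZMod (k + 1)) = b
    · rw [up _ hr]
      refine ⟨by omega, ?_, fun l hl hl' => ?_⟩
      · push_cast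
        rw [hr, Set.mem_insert_iff, not_or]
        exact ⟨hne, hb'⟩
      · rcases (show l < D j ∨ l = D j by omega) with h | rfl
        · exact Or.inr (h₃ l hl h)
        · exact Or.inl hr
    · have hr' : (D j : ZMod (k + 1)) ≠ b + 1 := by
        intro h
        have hpred : ((D j - 1 : ℤ) : ZMod (k + 1)) = b := by push_cast; rw [h]; ring
        rcases (show D j = j ∨ j ≤ D j - 1 by omega) with h' | h'
        · rw [h'] at hpred
          exact hjb hpred
        · exact hb (hpred ▸ h₃ _ h' (by omega))
      rw [fixed _ hr hr']
      exact ⟨h₁, by rw [Set.mem_insert_iff, not_or]; exact ⟨hr, h₂⟩,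
        fun l hl hl' => Or.inr (h₃ l hl hl')⟩
  refine ⟨fun j hj => ?_, fun j hj => (jump j hj).1, fun j hj => (jump j hj).2.1,
    fun j hj => (jump j hj).2.2⟩
  rw [Equiv.Perm.mul_apply]
  by_cases hjS : ((j - 1 : ℤ) : ZMod (k + 1)) ∈ S
  · rw [hD.apply_of_mem j hjS]
    exact fixed _ (fun h => hb (h ▸ hjS)) (fun h => hb' (h ▸ hjS))
  · have hjb : (j : ZMod (k + 1)) = b + 1 := by
      have := hj.resolve_right hjS
      rw [← this]
      push_cast
      ring
    have hDj : D j = j := by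
      by_contra h
      have hle := hD.le_apply j hjS
      exact hb' (hjb ▸ hD.mem_of_lt_apply j hjS j le_rfl (by omega))
    rw [hDj, down j hjb]

theorem isCycDecreasing_prod_range {k : ℕ} (hk : 1 ≤ k) {A : Finset (ZMod (k + 1))}
    {g : ZMod (k + 1)} (hg : g ∉ A) (n : ℕ) (hn : n ≤ k + 1) :
    IsCycDecreasing k {a | a ∈ A ∧ (a - g).val < n}
      ((((List.range n).reverse.map fun t : ℕ => g + (t : ZMod (k + 1))).filter
        fun a => decide (a ∈ A)).map (sAff k)).prod := by
  induction n with
  | zero => simpa using isCycDecreasing_one k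
  | succ n ih =>
    specialize ih (by omega)
    have hval : ∀ a : ZMod (k + 1), (a - g).val = n ↔ a = g + n := by
      intro a
      constructor
      · intro h
        rw [← h, ZMod.natCast_zmod_val]
        ring
      · rintro rfl
        rw [add_sub_cancel_left, ZMod.val_natCast_of_lt (by omega)]
    simp only [List.range_succ, List.reverse_append, List.reverse_singleton, List.singleton_append,
      List.map_cons, List.filter_cons]
    by_cases hmem : g + (n : ZMod (k + 1)) ∈ A
    · have hset : {a | a ∈ A ∧ (a - g).val < n + 1} =
          insert (g + (n : ZMod (k + 1))) {a | a ∈ A ∧ (a - g).val < n} := by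
        ext a
        simp only [Set.mem_ofPred_eq, Set.mem_insert_iff, Nat.lt_succ_iff_lt_or_eq, hval]
        constructor
        · rintro ⟨h, h' | h'⟩
          exacts [Or.inr ⟨h, h'⟩, Or.inl h']
        · rintro (rfl | ⟨h, h'⟩)
          exacts [⟨hmem, Or.inr rfl⟩, ⟨h, Or.inl h'⟩]
      rw [hset, if_pos (by simpa using hmem), List.map_cons, List.prod_cons]
      refine ih.sAff_mul hk (fun h => ?_) (fun h => ?_)
      · exact h.2.ne ((hval _).mpr rfl)
      · rcases (show n = k ∨ n + 1 < k + 1 by omega) with rfl | hlt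
        · have hcast : (n : ZMod (n + 1)) + 1 = 0 := by
            exact_mod_cast ZMod.natCast_self (n + 1)
          rw [add_assoc, hcast, add_zero] at h
          exact hg h.1
        · have h₂ : (g + (n : ZMod (k + 1)) + 1 - g).val < n := h.2
          have hcast : g + (n : ZMod (k + 1)) + 1 - g = ((n + 1 : ℕ) : ZMod (k + 1)) := by
            push_cast
            ring
          rw [hcast, ZMod.val_natCast_of_lt hlt] at h₂
          omega
    · have hset : {a | a ∈ A ∧ (a - g).val < n + 1} = {a | a ∈ A ∧ (a - g).val < n} := by
        ext a
        simp only [Set.mem_ofPred_eq, Nat.lt_succ_iff_lt_or_eq, hval]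
        constructor
        · rintro ⟨h, h' | rfl⟩
          exacts [⟨h, h'⟩, absurd h hmem]
        · exact fun h => ⟨h.1, Or.inl h.2⟩
      rw [hset, if_neg (by simpa using hmem)]
      exact ih

theorem isCycDecreasing_dElt {k : ℕ} (hk : 1 ≤ k) {A : Finset (ZMod (k + 1))}
    (hA : A ≠ Finset.univ) : IsCycDecreasing k A (dElt k A) := by
  have hex : ∃ g, g ∉ A := by
    by_contra! h
    exact hA (Finset.eq_univ_iff_forall.mpr h)
  have hg : gate k A ∉ A := by
    rw [gate, dif_pos hex]
    exact hex.choose_spec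
  have hset : {a | a ∈ A ∧ (a - gate k A).val < k + 1} = (A : Set (ZMod (k + 1))) := by
    ext a
    simpa using fun _ => Nat.le_of_lt_succ (ZMod.val_lt (a - gate k A))
  have h := isCycDecreasing_prod_range hk hg (k + 1) le_rfl
  rw [hset] at h
  exact h

/-- The positions to the left of `i` carrying a value larger than the one at `i`. -/
def leftInversions (x : Equiv.Perm ℤ) (i : ℤ) : Set ℤ := {j | j < i ∧ x i < x j}

theorem leftInversions_mul_eq_empty {k : ℕ} {S : Set (ZMod (k + 1))} {y D : Equiv.Perm ℤ}
    (hD : IsCycDecreasing k S D)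
    (hy : ∀ r : ℤ, (r : ZMod (k + 1)) ∉ S → leftInversions y r = ∅) {i : ℤ}
    (hi : ((i - 1 : ℤ) : ZMod (k + 1)) ∉ S) : leftInversions (y * D) i = ∅ := by
  refine Set.eq_empty_of_forall_notMem fun j hj => ?_
  obtain ⟨hji, hlt⟩ := hj
  have hle := hD.le_apply i hi
  have hDlt : D j < D i := by
    by_cases hj : ((j - 1 : ℤ) : ZMod (k + 1)) ∈ S
    · rw [hD.apply_of_mem j hj]
      omega
    · by_contra! h
      exact hi (hD.mem_of_lt_apply j hj (i - 1) (by omega) (by omega))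
  have hmem : D j ∈ leftInversions y (D i) := ⟨hDlt, hlt⟩
  rw [hy _ (hD.apply_notMem i hi)] at hmem
  exact hmem

theorem exists_least_ge_notMem {k : ℕ} {S : Set (ZMod (k + 1))} (hS : S ≠ Set.univ) (i : ℤ) :
    ∃ r : ℤ, i ≤ r ∧ (r : ZMod (k + 1)) ∉ S ∧ ∀ l, i ≤ l → l < r → (l : ZMod (k + 1)) ∈ S := by
  obtain ⟨g, hg⟩ := (Set.ne_univ_iff_exists_notMem S).mp hS
  obtain ⟨r, ⟨hr, hrS⟩, hmin⟩ := Int.exists_least_of_bdd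
    (P := fun r : ℤ => i ≤ r ∧ (r : ZMod (k + 1)) ∉ S) ⟨i, fun z hz => hz.1⟩
    ⟨i + ((g - i).val : ℤ), by omega, by
      push_cast
      rw [ZMod.natCast_zmod_val, add_sub_cancel]
      exact hg⟩
  refine ⟨r, hr, hrS, fun l hl hlr => ?_⟩
  by_contra h
  exact absurd (hmin l ⟨hl, h⟩) (not_le.mpr hlr)

theorem image_leftInversions_mul {k : ℕ} {S : Set (ZMod (k + 1))} {y D : Equiv.Perm ℤ}
    (hD : IsCycDecreasing k S D)
    (hy : ∀ r : ℤ, (r : ZMod (k + 1)) ∉ S → leftInversions y r = ∅) {i r : ℤ}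
    (hi : ((i - 1 : ℤ) : ZMod (k + 1)) ∈ S) (hir : i ≤ r) (hr : (r : ZMod (k + 1)) ∉ S)
    (hmin : ∀ l, i ≤ l → l < r → (l : ZMod (k + 1)) ∈ S) :
    D '' leftInversions (y * D) i = insert r (leftInversions y (i - 1)) := by
  have hyr : y (i - 1) < y r := by
    by_contra! h
    have hne : y r ≠ y (i - 1) := fun h' => by
      have := y.injective h'
      omega
    have hmem : i - 1 ∈ leftInversions y r := ⟨by omega, lt_of_le_of_ne h hne⟩
    rw [hy r hr] at hmem
    exact hmem
  have hDi : (y * D) i = y (i - 1) := by rw [Equiv.Perm.mul_apply, hD.apply_of_mem i hi]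
  ext l
  rw [Set.mem_image, Set.mem_insert_iff]
  constructor
  · rintro ⟨j, ⟨hji, hlt⟩, rfl⟩
    rw [hDi] at hlt
    by_cases hj : ((j - 1 : ℤ) : ZMod (k + 1)) ∈ S
    · refine Or.inr ⟨?_, hlt⟩
      rw [hD.apply_of_mem j hj]
      omega
    · have h₂ := hD.apply_notMem j hj
      have h₃ := hD.mem_of_lt_apply j hj
      rcases lt_trichotomy (D j) (i - 1) with h | h | h
      · exact Or.inr ⟨h, hlt⟩
      · rw [h] at h₂
        exact absurd hi h₂
      · refine Or.inl ?_
        rcases lt_trichotomy (D j) r with h' | h' | h'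
        · exact absurd (hmin _ (by omega) h') h₂
        · exact h'
        · exact absurd (h₃ r (by omega) h') hr
  · obtain ⟨j, rfl⟩ := D.surjective l
    intro hl
    refine ⟨j, ⟨?_, ?_⟩, rfl⟩
    · by_cases hj : ((j - 1 : ℤ) : ZMod (k + 1)) ∈ S
      · have hDj := hD.apply_of_mem j hj
        rcases hl with hl | hl
        · rw [← hl, hDj] at hr
          exact absurd hj hr
        · have := hl.1
          omega
      · have h₁ := hD.le_apply j hj
        rcases hl with hl | hl
        · by_contra! h
          rcases h.eq_or_lt with rfl | h
          · exact hj hi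
          · exact hj (hmin (j - 1) (by omega) (by omega))
        · have := hl.1
          omega
    · rw [hDi]
      rcases hl with hl | hl
      · rw [Equiv.Perm.mul_apply, hl]
        exact hyr
      · exact hl.2

/-- The `k`-code of a sequence of subsets: `#{m : i − m ∈ A_m}`. -/
def kCode (k : ℕ) (L : List (Finset (ZMod (k + 1)))) (i : ZMod (k + 1)) : ℕ :=
  ((Finset.range L.length).filter
    (fun m => i - ((m + 1 : ℕ) : ZMod (k + 1)) ∈ L.getD m ∅)).card

theorem kCode_cons (k : ℕ) (A : Finset (ZMod (k + 1))) (L : List (Finset (ZMod (k + 1))))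
    (i : ZMod (k + 1)) :
    kCode k (A :: L) i = kCode k L (i - 1) + if i - 1 ∈ A then 1 else 0 := by
  have hshift : ∀ m : ℕ, i - ((m + 1 + 1 : ℕ) : ZMod (k + 1)) =
      i - 1 - ((m + 1 : ℕ) : ZMod (k + 1)) := fun m => by
    push_cast
    ring
  simp only [kCode, Finset.card_filter, List.length_cons, Finset.sum_range_succ',
    List.getD_cons_succ, List.getD_cons_zero, hshift]
  simp

theorem kCode_eq_zero_of_notMem {k : ℕ} {A : Finset (ZMod (k + 1))}
    {L : List (Finset (ZMod (k + 1)))}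
    (hchain : List.IsChain (fun A B => B ⊆ A.image (fun a => a - 1)) (A :: L))
    {i : ZMod (k + 1)} (hi : i ∉ A) : kCode k L i = 0 := by
  induction L generalizing A i with
  | nil => simp [kCode]
  | cons B L ih =>
    rw [List.isChain_cons_cons] at hchain
    have hB : i - 1 ∉ B := fun h => by
      obtain ⟨a, ha, hai⟩ := Finset.mem_image.mp (hchain.1 h)
      exact hi (sub_left_injective hai ▸ ha)
    rw [kCode_cons, ih hchain.2 hB, if_neg hB]

theorem finite_leftInversions_and_ncard_eq_kCode {k : ℕ} (hk : 1 ≤ k)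
    (L : List (Finset (ZMod (k + 1)))) (hL : ∀ A ∈ L, A ≠ Finset.univ)
    (hchain : List.IsChain (fun A B => B ⊆ A.image (fun a => a - 1)) L) (i : ℤ) :
    (leftInversions (L.reverse.map (dElt k)).prod i).Finite ∧
      (leftInversions (L.reverse.map (dElt k)).prod i).ncard = kCode k L i := by
  induction L generalizing i with
  | nil =>
    have hempty : leftInversions 1 i = ∅ :=
      Set.eq_empty_of_forall_notMem fun j hj => absurd hj.1 (not_lt.mpr hj.2.le)
    simp [hempty, kCode]
  | cons A L ih =>
    specialize ih (fun B hB => hL B (List.mem_cons_of_mem _ hB)) hchain.tail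
    have hA := hL A List.mem_cons_self
    have hD := isCycDecreasing_dElt hk hA
    rw [List.reverse_cons, List.map_append, List.prod_append, List.map_singleton,
      List.prod_singleton, kCode_cons]
    set y := (L.reverse.map (dElt k)).prod
    have hy : ∀ r : ℤ, (r : ZMod (k + 1)) ∉ (A : Set (ZMod (k + 1))) →
        leftInversions y r = ∅ := fun r hr => by
      rw [← Set.ncard_eq_zero (ih r).1, (ih r).2]
      exact kCode_eq_zero_of_notMem hchain (by simpa using hr)
    have hcast : ((i - 1 : ℤ) : ZMod (k + 1)) = (i : ZMod (k + 1)) - 1 := by push_cast; rfl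
    by_cases hi : (i : ZMod (k + 1)) - 1 ∈ A
    · have hi' : ((i - 1 : ℤ) : ZMod (k + 1)) ∈ (A : Set (ZMod (k + 1))) := by
        rw [hcast]
        exact hi
      obtain ⟨r, hir, hr, hmin⟩ := exists_least_ge_notMem
        (S := (A : Set (ZMod (k + 1)))) (by simpa using hA) i
      have himage := image_leftInversions_mul hD hy hi' hir hr hmin
      have hrmem : r ∉ leftInversions y (i - 1) := fun h => by
        have := h.1
        omega
      refine ⟨Set.Finite.of_finite_image (f := dElt k A) ?_ (dElt k A).injective.injOn, ?_⟩
      · rw [himage]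
        exact (ih _).1.insert r
      · rw [← Set.ncard_image_of_injective _ (dElt k A).injective, himage,
          Set.ncard_insert_of_notMem hrmem (ih _).1, (ih _).2, if_pos hi, hcast]
    · rw [leftInversions_mul_eq_empty hD hy (by rw [hcast]; exact hi), if_neg hi,
        kCode_eq_zero_of_notMem hchain hi]
      exact ⟨Set.finite_empty, Set.ncard_empty _⟩

/-- the affine code coincides with the k-code of the canonical
cyclically decreasing decomposition: `CRD(x)_i = #{m : i − m ∈ A_m}`. -/
theorem crd_eq_code_of_canonical (k : ℕ) (hk : 1 ≤ k) (x : Equiv.Perm ℤ)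
    (hx : IsAffinePerm k x) (L : List (Finset (ZMod (k + 1))))
    (hL : ∀ A ∈ L, A.Nonempty ∧ A ≠ Finset.univ)
    (hchain : List.Chain' (fun A B => B ⊆ A.image (fun a => a - 1)) L)
    (hprod : x = (L.reverse.map (dElt k)).prod)
    (hlen : affLen k x = (L.map Finset.card).sum) :
    ∀ i : ZMod (k + 1),
      CRD k x i =
        ((Finset.range L.length).filter
          (fun m => i - ((m + 1 : ℕ) : ZMod (k + 1)) ∈ L.getD m ∅)).card := by
  intro i
  rw [hprod]
  have h := (finite_leftInversions_and_ncard_eq_kCode hk L (fun A hA => (hL A hA).2) hchain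
    (i.val : ℤ)).2
  rw [Int.cast_natCast, ZMod.natCast_zmod_val] at h
  exact h
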